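/- Suppose q is a prime power, k ≥ 2, and -1 is a k-th power in F_q. Then the independence number of the 2-fold strong product satisfies α(Paley_k(F_q) ⊠ Paley_k(F_q)) ≤ q^(2(1 - 1/k)). -/

import Mathlib

section

open Finset

open scoped Classical in
/-- The real part of the Gauss period of `H` at `y`. -/
noncomputable def gaussPeriod {K : Type*} [Field K] [Fintype K] (ψ : AddChar K ℂ)
    (H : Subgroup Kˣ) (y : K) : ℝ :=
  (∑ h : H, ψ ((h : Kˣ) * y)).re

/-- A function on `K` whose Fourier coefficients are nonnegative, the one at `0` being at
least `1`. -/
def HasDominatingSpectrum {K : Type*} [Field K] [Fintype K] (ψ : AddChar K ℂ) (g : K → ℂ) : Prop :=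
  ∃ c : K → ℝ, (∀ y, 0 ≤ c y) ∧ 1 ≤ c 0 ∧ ∀ x, g x = ∑ y, (c y : ℂ) * ψ (y * x)

open scoped Classical

variable {K : Type*} [Field K] [Fintype K] {ψ : AddChar K ℂ}

lemma AddChar.IsPrimitive.sum_mul_left (hψ : ψ.IsPrimitive) (b : K) :
    ∑ x, ψ (b * x) = if b = 0 then (Fintype.card K : ℂ) else 0 := by
  simp_rw [mul_comm b, AddChar.sum_mulShift _ hψ]
  split_ifs <;> simp

lemma HasDominatingSpectrum.one : HasDominatingSpectrum ψ (1 : K → ℂ) :=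
  ⟨fun y => if y = 0 then 1 else 0, fun y => by positivity, by simp, fun x => by
    simp [apply_ite, ite_mul]⟩

lemma HasDominatingSpectrum.mul {f g : K → ℂ} (hf : HasDominatingSpectrum ψ f)
    (hg : HasDominatingSpectrum ψ g) : HasDominatingSpectrum ψ (f * g) := by
  obtain ⟨a, ha, ha0, hfa⟩ := hf
  obtain ⟨b, hb, hb0, hgb⟩ := hg
  refine ⟨fun z => ∑ y, a y * b (z - y), fun z => sum_nonneg fun y _ => mul_nonneg (ha y) (hb _),
    ?_, fun x => ?_⟩
  · have h : a 0 * b (0 - 0) ≤ ∑ y, a y * b (0 - y) :=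
      single_le_sum (f := fun y => a y * b (0 - y))
        (fun y _ => mul_nonneg (ha y) (hb _)) (mem_univ 0)
    rw [sub_zero] at h
    exact (one_le_mul_of_one_le_of_one_le ha0 hb0).trans h
  · rw [Pi.mul_apply, hfa, hgb, sum_mul_sum]
    push_cast
    simp_rw [sum_mul]
    rw [sum_comm (s := univ) (t := univ) (f := fun z y => ((a y : ℂ) * b (z - y)) * ψ (z * x))]
    refine sum_congr rfl fun y _ => ?_
    refine Fintype.sum_equiv (Equiv.addLeft y) _ _ fun w => ?_
    simp only [Equiv.coe_addLeft, add_sub_cancel_left, add_mul, AddChar.map_add_eq_mul]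
    ring

lemma HasDominatingSpectrum.prod {ι : Type*} (s : Finset ι) {g : ι → K → ℂ}
    (hg : ∀ i ∈ s, HasDominatingSpectrum ψ (g i)) : HasDominatingSpectrum ψ (∏ i ∈ s, g i) :=
  prod_induction g _ (fun _ _ => HasDominatingSpectrum.mul) .one hg

lemma HasDominatingSpectrum.card_le_sum (hψ : ψ.IsPrimitive) {g : K → ℂ}
    (hg : HasDominatingSpectrum ψ g) : (Fintype.card K : ℝ) ≤ (∑ x, g x).re := by
  obtain ⟨c, -, hc0, hgc⟩ := hg
  have h : ∑ x, g x = ((c 0 * Fintype.card K : ℝ) : ℂ) := by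
    simp_rw [hgc]
    rw [sum_comm]
    simp_rw [← mul_sum, hψ.sum_mul_left]
    simp
  rw [h, Complex.ofReal_re]
  exact le_mul_of_one_le_left (Nat.cast_nonneg _) hc0

variable (ψ) (H : Subgroup Kˣ)

lemma ofReal_gaussPeriod (hH : -1 ∈ H) (y : K) :
    (gaussPeriod ψ H y : ℂ) = ∑ h : H, ψ ((h : Kˣ) * y) := by
  rw [gaussPeriod, ← Complex.conj_eq_iff_re, map_sum]
  refine Fintype.sum_equiv (Equiv.mulLeft (⟨-1, hH⟩ : H)) _ _ fun h => ?_
  rw [← AddChar.map_neg_eq_conj]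
  simp

lemma gaussPeriod_zero : gaussPeriod ψ H 0 = Nat.card H := by
  simp [gaussPeriod]

lemma gaussPeriod_unit_mul {u : Kˣ} (hu : u ∈ H) (y : K) :
    gaussPeriod ψ H (u * y) = gaussPeriod ψ H y := by
  unfold gaussPeriod
  congr 1
  refine Fintype.sum_equiv (Equiv.mulRight (⟨u, hu⟩ : H)) _ _ fun h => ?_
  simp [mul_assoc]

variable {ψ}

lemma sum_gaussPeriod (hψ : ψ.IsPrimitive) : ∑ y, gaussPeriod ψ H y = 0 := by
  unfold gaussPeriod
  rw [← Complex.re_sum, sum_comm]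
  simp_rw [hψ.sum_mul_left]
  simp

lemma exists_neg_min_gaussPeriod (hψ : ψ.IsPrimitive) :
    ∃ a : Kˣ, gaussPeriod ψ H a < 0 ∧ ∀ y, gaussPeriod ψ H a ≤ gaussPeriod ψ H y := by
  obtain ⟨a, -, ha⟩ := exists_min_image univ (gaussPeriod ψ H) univ_nonempty
  have h0 : 0 < gaussPeriod ψ H 0 := by
    rw [gaussPeriod_zero]
    exact_mod_cast Nat.card_pos
  have hneg : gaussPeriod ψ H a < 0 := by
    by_contra! h
    exact (sum_pos' (fun y _ => h.trans (ha y (mem_univ y))) ⟨0, mem_univ 0, h0⟩).ne'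
      (sum_gaussPeriod H hψ)
  have ha0 : a ≠ 0 := by
    rintro rfl
    exact hneg.not_gt h0
  exact ⟨Units.mk0 a ha0, hneg, fun y => ha y (mem_univ y)⟩

lemma HasDominatingSpectrum.one_add_gaussPeriod (hH : -1 ∈ H) {μ : ℝ} (hμ : 0 < μ) (s : K) :
    HasDominatingSpectrum ψ (fun x => ((1 + gaussPeriod ψ H (s * x) / μ : ℝ) : ℂ)) := by
  refine ⟨fun y => (if y = 0 then 1 else 0) +
    (∑ h : H, if y = (h : Kˣ) * s then 1 else 0) / μ, fun y => by positivity, ?_, fun x => ?_⟩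
  · simp only [if_true]
    exact le_add_of_nonneg_right (by positivity)
  · push_cast
    rw [ofReal_gaussPeriod ψ H hH]
    simp_rw [add_mul, sum_add_distrib, div_mul_eq_mul_div, sum_mul, ← sum_div]
    rw [sum_comm (s := univ) (t := univ)]
    simp [mul_assoc, apply_ite, ite_mul]

/-- The Hoffman ratio of the Cayley graph of `H` raised to the index of `H` is at least the order
of the field. -/
lemma card_le_one_add_div_pow_index (hψ : ψ.IsPrimitive) (hH : -1 ∈ H) {μ : ℝ} (hμ : 0 < μ)
    {a : Kˣ} (ha : gaussPeriod ψ H a = -μ) :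
    (Fintype.card K : ℝ) ≤ (1 + Nat.card H / μ) ^ H.index := by
  have key := (HasDominatingSpectrum.prod (ψ := ψ) univ (g := fun (c : Kˣ ⧸ H) x =>
    ((1 + gaussPeriod ψ H (((a * c.out⁻¹ : Kˣ) : K) * x) / μ : ℝ) : ℂ))
    fun c _ => .one_add_gaussPeriod H hH hμ _).card_le_sum hψ
  rw [Fintype.sum_eq_single 0] at key
  · simp only [prod_apply, mul_zero, gaussPeriod_zero, prod_const, card_univ] at key
    rwa [← Complex.ofReal_pow, Complex.ofReal_re, ← Nat.card_eq_fintype_card (α := Kˣ ⧸ H)] at key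
  · intro x hx
    rw [prod_apply]
    refine prod_eq_zero (mem_univ (QuotientGroup.mk (Units.mk0 x hx))) ?_
    set u := Units.mk0 x hx
    have hmem : (QuotientGroup.mk u : Kˣ ⧸ H).out⁻¹ * u ∈ H :=
      QuotientGroup.eq.mp (Quotient.out_eq' _)
    have : ((a * (QuotientGroup.mk u : Kˣ ⧸ H).out⁻¹ : Kˣ) : K) * x =
        (((QuotientGroup.mk u : Kˣ ⧸ H).out⁻¹ * u : Kˣ) : K) * a := by
      rw [show x = (u : K) from rfl, ← Units.val_mul, ← Units.val_mul]
      congr 1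
      rw [mul_assoc, mul_comm]
    rw [this, gaussPeriod_unit_mul ψ H hmem, ha]
    simp [hμ.ne']

/-- Fourier inversion for the indicator of `0` plus `μ⁻¹` times the indicator of `H`. -/
lemma delta_add_indicator_eq (hψ : ψ.IsPrimitive) (hH : -1 ∈ H) (μ : ℝ) (x : K) :
    ((if x = 0 then 1 else 0) + (∑ h : H, if x = (h : Kˣ) then 1 else 0) / μ : ℂ) =
      ∑ y, (((1 + gaussPeriod ψ H y / μ) / Fintype.card K : ℝ) : ℂ) * ψ (y * x) := by
  have hq : (Fintype.card K : ℂ) ≠ 0 := Nat.cast_ne_zero.mpr Fintype.card_ne_zero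
  have hδ (z : K) : (if z = 0 then 1 else 0 : ℂ) = (∑ y, ψ (y * z)) / Fintype.card K := by
    rw [AddChar.sum_mulShift _ hψ]
    split_ifs <;> simp [hq]
  have hh (h : H) : (if x = (h : Kˣ) then 1 else 0 : ℂ) =
      (∑ y, ψ ((-1 * h : Kˣ) * y) * ψ (y * x)) / Fintype.card K := by
    rw [← if_congr (sub_eq_zero (a := x) (b := ((h : Kˣ) : K))) rfl rfl, hδ]
    congr 1
    refine sum_congr rfl fun y _ => ?_
    rw [← AddChar.map_add_eq_mul]
    congr 1
    push_cast
    ring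
  rw [hδ]
  simp_rw [hh]
  rw [← sum_div, sum_comm]
  simp_rw [← sum_mul]
  have hsum (y : K) : ∑ h : H, ψ ((-1 * h : Kˣ) * y) = (gaussPeriod ψ H y : ℂ) := by
    rw [ofReal_gaussPeriod ψ H hH]
    exact Fintype.sum_equiv (Equiv.mulLeft (⟨-1, hH⟩ : H)) _ _ fun h => by simp
  simp_rw [hsum]
  push_cast
  simp_rw [add_div, add_mul, sum_add_distrib, sum_div]
  congr 1
  · exact sum_congr rfl fun y _ => by ring
  · exact sum_congr rfl fun y _ => by ring

lemma sum_sum_mul_addChar_sub (S : Finset (K × K)) (y w : K) :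
    ∑ p ∈ S, ∑ r ∈ S, ψ (y * (p.1 - r.1)) * ψ (w * (p.2 - r.2)) =
      ((‖∑ p ∈ S, ψ (y * p.1 + w * p.2)‖ ^ 2 : ℝ) : ℂ) := by
  rw [Complex.ofReal_pow, ← Complex.mul_conj', map_sum, sum_mul_sum]
  refine sum_congr rfl fun p _ => sum_congr rfl fun r _ => ?_
  rw [← AddChar.map_neg_eq_conj, ← AddChar.map_add_eq_mul, ← AddChar.map_add_eq_mul]
  congr 1
  ring

/-- The Delsarte bound in `K × K` for a function `f ⊗ f` with nonnegative Fourier coefficients. -/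
lemma sq_mul_card_le_one_of_spectrum {f : K → ℂ} {b : K → ℝ} (hb : ∀ y, 0 ≤ b y)
    (hf : ∀ x, f x = ∑ y, (b y : ℂ) * ψ (y * x)) (hf0 : f 0 = 1) (S : Finset (K × K))
    (hS : ∀ p ∈ S, ∀ r ∈ S, p ≠ r → f (p.1 - r.1) * f (p.2 - r.2) = 0) :
    b 0 ^ 2 * #S ≤ 1 := by
  have h1 : ∑ p ∈ S, ∑ r ∈ S, f (p.1 - r.1) * f (p.2 - r.2) = #S := by
    rw [card_eq_sum_ones, Nat.cast_sum]
    refine sum_congr rfl fun p hp => ?_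
    rw [sum_eq_single_of_mem p hp fun r hr hrp => hS p hp r hr hrp.symm]
    simp [hf0]
  have h2 : ∑ p ∈ S, ∑ r ∈ S, f (p.1 - r.1) * f (p.2 - r.2) =
      ((∑ y, ∑ w, b y * b w * ‖∑ p ∈ S, ψ (y * p.1 + w * p.2)‖ ^ 2 : ℝ) : ℂ) := by
    trans ∑ p ∈ S, ∑ y, ∑ w, ∑ r ∈ S,
      (b y : ℂ) * b w * (ψ (y * (p.1 - r.1)) * ψ (w * (p.2 - r.2)))
    · refine sum_congr rfl fun p _ => ?_
      simp_rw [hf, sum_mul_sum, mul_mul_mul_comm]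
      rw [sum_comm]
      exact sum_congr rfl fun y _ => sum_comm
    · rw [sum_comm, Complex.ofReal_sum]
      refine sum_congr rfl fun y _ => ?_
      rw [sum_comm, Complex.ofReal_sum]
      refine sum_congr rfl fun w _ => ?_
      rw [Complex.ofReal_mul, Complex.ofReal_mul, ← sum_sum_mul_addChar_sub]
      simp_rw [mul_sum]
  have h3 : (#S : ℝ) = ∑ y, ∑ w, b y * b w * ‖∑ p ∈ S, ψ (y * p.1 + w * p.2)‖ ^ 2 := by
    exact_mod_cast h1.symm.trans h2
  have hnn (y w : K) : 0 ≤ b y * b w * ‖∑ p ∈ S, ψ (y * p.1 + w * p.2)‖ ^ 2 :=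
    mul_nonneg (mul_nonneg (hb y) (hb w)) (by positivity)
  have h4 : b 0 * b 0 * (#S : ℝ) ^ 2 ≤ #S := by
    calc b 0 * b 0 * (#S : ℝ) ^ 2
        = b 0 * b 0 * ‖∑ p ∈ S, ψ (0 * p.1 + 0 * p.2)‖ ^ 2 := by simp
      _ ≤ ∑ w, b 0 * b w * ‖∑ p ∈ S, ψ (0 * p.1 + w * p.2)‖ ^ 2 :=
          single_le_sum (f := fun w => b 0 * b w * ‖∑ p ∈ S, ψ (0 * p.1 + w * p.2)‖ ^ 2)
            (fun w _ => hnn 0 w) (mem_univ 0)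
      _ ≤ ∑ y, ∑ w, b y * b w * ‖∑ p ∈ S, ψ (y * p.1 + w * p.2)‖ ^ 2 :=
          single_le_sum
            (f := fun y => ∑ w, b y * b w * ‖∑ p ∈ S, ψ (y * p.1 + w * p.2)‖ ^ 2)
            (fun y _ => sum_nonneg fun w _ => hnn y w) (mem_univ 0)
      _ = #S := h3.symm
  rcases S.eq_empty_or_nonempty with rfl | hne
  · simp
  · have hpos : (0 : ℝ) < #S := by exact_mod_cast hne.card_pos
    nlinarith

/-- The Hoffman bound for the strong square of the Cayley graph of `H`. -/
lemma sq_mul_card_le_of_strong_indep (hψ : ψ.IsPrimitive) (hH : -1 ∈ H) {μ : ℝ} (hμ : 0 < μ)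
    (hmin : ∀ y, -μ ≤ gaussPeriod ψ H y) (S : Finset (K × K))
    (hS : ∀ p ∈ S, ∀ r ∈ S, p ≠ r →
      ¬ ((p.1 = r.1 ∨ ∃ u ∈ H, p.1 - r.1 = u) ∧ (p.2 = r.2 ∨ ∃ u ∈ H, p.2 - r.2 = u))) :
    (1 + Nat.card H / μ) ^ 2 * #S ≤ (Fintype.card K : ℝ) ^ 2 := by
  have hzero {x y : K} (hx : ¬ (x = y ∨ ∃ u ∈ H, x - y = u)) :
      ((if x - y = 0 then 1 else 0) +
        (∑ h : H, if x - y = (h : Kˣ) then 1 else 0) / μ : ℂ) = 0 := by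
    simp only [not_or, not_exists, not_and] at hx
    rw [if_neg (sub_ne_zero.mpr hx.1), sum_eq_zero fun (h : H) _ => if_neg (hx.2 h h.2)]
    simp
  have h := sq_mul_card_le_one_of_spectrum (ψ := ψ) (f := fun x =>
    (if x = 0 then 1 else 0) + (∑ h : H, if x = (h : Kˣ) then 1 else 0) / μ)
    (b := fun y => (1 + gaussPeriod ψ H y / μ) / Fintype.card K) (fun y => ?_)
    (delta_add_indicator_eq H hψ hH μ) (by simp [eq_comm (a := (0 : K))]) S
    (fun p hp r hr hpr => ?_)
  · have hq : (0 : ℝ) < Fintype.card K := by exact_mod_cast Fintype.card_pos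
    simp only [gaussPeriod_zero] at h
    rwa [div_pow, div_mul_eq_mul_div, div_le_one (by positivity)] at h
  · have : -1 ≤ gaussPeriod ψ H y / μ := by
      rw [le_div_iff₀ hμ]
      linarith [hmin y]
    exact div_nonneg (by linarith) (Nat.cast_nonneg _)
  · rcases not_and_or.mp (hS p hp r hr hpr) with h | h
    · simp only [hzero h, zero_mul]
    · simp only [hzero h, mul_zero]

end

/-- If `-1` is a k-th power in `F_q`, then any independent set in the 2-fold strong
product `Paley_k(F_q) ⊠ Paley_k(F_q)` has size at most `q^(2(1 - 1/k))`. -/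
theorem paley_product_indep_upper {K : Type*} [Field K] [Fintype K] (q k : ℕ)
    (hq : Fintype.card K = q) (hk : 2 ≤ k) (hm1 : ∃ z : K, z ^ k = -1) :
    ∀ S : Finset (K × K),
      (∀ p ∈ S, ∀ r ∈ S, p ≠ r →
        ¬ ((p.1 = r.1 ∨ ∃ z : K, p.1 - r.1 = z ^ k) ∧
           (p.2 = r.2 ∨ ∃ z : K, p.2 - r.2 = z ^ k))) →
      (S.card : ℝ) ≤ (q : ℝ) ^ ((2 : ℝ) * (1 - 1 / (k : ℝ))) := by
  intro S hS
  have hψ := AddChar.FiniteField.primitiveChar_to_Complex_isPrimitive K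
  set ψ := AddChar.FiniteField.primitiveChar_to_Complex K
  set H := (powMonoidHom k : Kˣ →* Kˣ).range with hHdef
  have hH : -1 ∈ H := by
    obtain ⟨z, hz⟩ := hm1
    have hz0 : z ≠ 0 := by
      rintro rfl
      rw [zero_pow (by omega)] at hz
      exact neg_ne_zero.mpr one_ne_zero hz.symm
    exact ⟨Units.mk0 z hz0, by ext; simpa using hz⟩
  have hpow {u : Kˣ} (hu : u ∈ H) : ∃ z : K, (u : K) = z ^ k := by
    obtain ⟨v, rfl⟩ := hu
    exact ⟨v, by simp⟩
  obtain ⟨a, ha, hmin⟩ := exists_neg_min_gaussPeriod H hψ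
  have hμ : 0 < -gaussPeriod ψ H a := neg_pos.mpr ha
  have hindex : H.index ≤ k := by
    rw [hHdef, IsCyclic.index_powMonoidHom_range]
    exact Nat.gcd_le_right _ (by omega)
  have h1 := card_le_one_add_div_pow_index H hψ hH hμ (neg_neg _).symm
  have h2 := sq_mul_card_le_of_strong_indep H hψ hH hμ (by simpa using hmin) S
    fun p hp r hr hpr h => hS p hp r hr hpr
      (h.imp (Or.imp_right fun ⟨u, hu, e⟩ => e ▸ hpow hu)
        (Or.imp_right fun ⟨u, hu, e⟩ => e ▸ hpow hu))
  set t : ℝ := 1 + Nat.card H / -gaussPeriod ψ H a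
  have ht : 1 ≤ t := le_add_of_nonneg_right (by positivity)
  rw [hq] at h1 h2
  have hq0 : (0 : ℝ) < q := by
    rw [← hq]
    exact_mod_cast Fintype.card_pos
  have hk0 : (k : ℝ) ≠ 0 := by
    norm_cast
    omega
  have hroot : (q : ℝ) ^ (1 / (k : ℝ)) ≤ t := by
    rw [one_div, Real.rpow_inv_le_iff_of_pos hq0.le (by linarith) (by positivity),
      Real.rpow_natCast]
    exact h1.trans (pow_le_pow_right₀ ht hindex)
  have hexp : (q : ℝ) ^ ((2 : ℝ) * (1 - 1 / (k : ℝ))) = q ^ 2 / (q ^ (1 / (k : ℝ))) ^ 2 := by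
    rw [mul_comm, Real.rpow_mul hq0.le, Real.rpow_sub hq0, Real.rpow_one, Real.rpow_two, div_pow]
  rw [hexp, le_div_iff₀ (by positivity), mul_comm]
  exact (mul_le_mul_of_nonneg_right (pow_le_pow_left₀ (by positivity) hroot 2)
    (Nat.cast_nonneg _)).trans h2
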